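/- Fix a natural number n and let T_n be the set of base-3/2 digit strings x such that v(x) = v(d) + 2n for some two-free base-3/2 digit string d. Then for every natural number m and every x ∈ T_n, the set { y m : y ∈ T_n and y i = x i for all i < m } has exactly two elements; that is, the strings in T_n satisfy the two-out-of-three property: their last digit takes exactly two of the three possible values, and for any realized suffix, the digit preceding that suffix takes exactly two possible values, both realized. -/

import Mathlib

/-- The value of a base-3/2 digit string. -/
def val32 (d : ℕ →₀ ℕ) : ℚ := d.sum fun i c => (c : ℚ) * (3 / 2 : ℚ) ^ i

/-- A digit string is two-free if all of its digits are 0 or 1. -/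
def TwoFree (d : ℕ →₀ ℕ) : Prop := ∀ i, d i ≤ 1

/-- `T n` is the set of base-3/2 digit strings whose value lies in
`S n = {v(d) + 2n : d two-free}`. -/
def T (n : ℕ) : Set (ℕ →₀ ℕ) :=
  {x | (∀ i, x i ≤ 2) ∧ ∃ d : ℕ →₀ ℕ, TwoFree d ∧ val32 x = val32 d + 2 * n}

theorem val32_eq_sum_range (x : ℕ →₀ ℕ) (N : ℕ) (h : ∀ i, N ≤ i → x i = 0) :
    val32 x = ∑ i ∈ Finset.range N, (x i : ℚ) * (3 / 2 : ℚ) ^ i := by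
  refine Finsupp.sum_of_support_subset x (fun i hi => ?_) _ (by simp)
  by_contra hc
  simp only [Finset.mem_range, not_lt] at hc
  exact Finsupp.mem_support_iff.mp hi (h i hc)

theorem exists_forall_ge_eq_zero (x : ℕ →₀ ℕ) : ∃ N, ∀ i, N ≤ i → x i = 0 := by
  refine ⟨x.support.sup id + 1, fun i hi => ?_⟩
  by_contra hc
  have := Finset.le_sup (f := id) (Finsupp.mem_support_iff.mpr hc)
  simp only [id] at this
  omega

/-- Removal of the last digit. -/
noncomputable def tail32 (x : ℕ →₀ ℕ) : ℕ →₀ ℕ :=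
  x.comapDomain Nat.succ Nat.succ_injective.injOn

/-- Addition of a new last digit. -/
noncomputable def cons32 (c : ℕ) (x : ℕ →₀ ℕ) : ℕ →₀ ℕ :=
  Finsupp.single 0 c + x.embDomain ⟨Nat.succ, Nat.succ_injective⟩

theorem tail32_apply (x : ℕ →₀ ℕ) (i : ℕ) : tail32 x i = x (i + 1) := rfl

theorem cons32_zero (c : ℕ) (x : ℕ →₀ ℕ) : cons32 c x 0 = c := by
  rw [cons32, Finsupp.add_apply, Finsupp.single_eq_same, Finsupp.embDomain_of_notMem_range]
  · rfl
  · simp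

theorem cons32_succ (c : ℕ) (x : ℕ →₀ ℕ) (i : ℕ) : cons32 c x (i + 1) = x i := by
  have h := Finsupp.embDomain_apply_self ⟨Nat.succ, Nat.succ_injective⟩ x i
  simp only [Function.Embedding.coeFn_mk, Nat.succ_eq_add_one] at h
  rw [cons32, Finsupp.add_apply, Finsupp.single_eq_of_ne (by omega), h, zero_add]

theorem tail32_cons32 (c : ℕ) (x : ℕ →₀ ℕ) : tail32 (cons32 c x) = x := by
  ext i
  rw [tail32_apply, cons32_succ]

theorem val32_eq_add_tail32 (x : ℕ →₀ ℕ) : val32 x = x 0 + 3 / 2 * val32 (tail32 x) := by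
  obtain ⟨N, hN⟩ := exists_forall_ge_eq_zero x
  rw [val32_eq_sum_range x (N + 1) fun i hi => hN i (by omega),
    val32_eq_sum_range (tail32 x) N fun i hi => hN (i + 1) (by omega),
    Finset.sum_range_succ', Finset.mul_sum, add_comm]
  congr 1
  · simp
  · refine Finset.sum_congr rfl fun i _ => ?_
    rw [tail32_apply]
    ring

theorem exists_two_pow_mul_val32 (x : ℕ →₀ ℕ) : ∃ N a : ℕ, (2 : ℚ) ^ N * val32 x = a := by
  obtain ⟨N, hN⟩ := exists_forall_ge_eq_zero x
  refine ⟨N, ∑ i ∈ Finset.range N, x i * (3 ^ i * 2 ^ (N - i)), ?_⟩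
  rw [val32_eq_sum_range x N hN, Finset.mul_sum]
  push_cast
  refine Finset.sum_congr rfl fun i hi => ?_
  have hi' : N = i + (N - i) := by
    have := Finset.mem_range.mp hi
    omega
  have h2 : (2 : ℚ) ^ N = 2 ^ i * 2 ^ (N - i) := by rw [← pow_add, ← hi']
  rw [h2, div_pow]
  field_simp

theorem three_dvd_of_val32_sub (x d : ℕ →₀ ℕ) (z : ℤ)
    (h : 3 * (val32 x - val32 d) = 2 * (z : ℚ)) : (3 : ℤ) ∣ z := by
  obtain ⟨N, a, ha⟩ := exists_two_pow_mul_val32 x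
  obtain ⟨M, b, hb⟩ := exists_two_pow_mul_val32 d
  have key : (3 : ℤ) * (2 ^ M * a - 2 ^ N * b) = 2 ^ (N + M + 1) * z := by
    have : (3 : ℚ) * (2 ^ M * a - 2 ^ N * b) = 2 ^ (N + M + 1) * z := by
      rw [← ha, ← hb]
      linear_combination (2 : ℚ) ^ (N + M) * h
    exact_mod_cast this
  have hc : IsCoprime (3 : ℤ) (2 ^ (N + M + 1)) :=
    IsCoprime.pow_right ⟨1, -1, by norm_num⟩
  exact hc.dvd_of_dvd_mul_left ⟨_, key.symm⟩

theorem mem_T_iff_tail32 (n : ℕ) (x : ℕ →₀ ℕ) :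
    x ∈ T n ↔ x 0 ≤ 2 ∧ ∃ e k : ℕ, e ≤ 1 ∧ x 0 + 3 * k = e + 2 * n ∧ tail32 x ∈ T k := by
  constructor
  · rintro ⟨hx, d, hd, hv⟩
    rw [val32_eq_add_tail32 x, val32_eq_add_tail32 d] at hv
    have h0 := hx 0
    obtain ⟨z, hz⟩ := three_dvd_of_val32_sub (tail32 x) (tail32 d)
      ((d 0 : ℤ) + 2 * n - x 0) (by push_cast; linarith)
    obtain ⟨k, rfl⟩ : ∃ k : ℕ, z = k := ⟨z.toNat, by omega⟩
    have hk : x 0 + 3 * k = d 0 + 2 * n := by omega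
    refine ⟨h0, d 0, k, hd 0, hk, fun i => hx (i + 1), tail32 d, fun i => hd (i + 1), ?_⟩
    have hk' : (x 0 : ℚ) + 3 * k = d 0 + 2 * n := by exact_mod_cast hk
    linarith
  · rintro ⟨h0, e, k, he, hk, hx, d, hd, hv⟩
    refine ⟨fun i => ?_, cons32 e d, fun i => ?_, ?_⟩
    · cases i with
      | zero => exact h0
      | succ i => exact hx i
    · cases i with
      | zero => rwa [cons32_zero]
      | succ i => rw [cons32_succ]; exact hd i
    · rw [val32_eq_add_tail32 x, val32_eq_add_tail32 (cons32 e d), cons32_zero, tail32_cons32]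
      have hk' : (x 0 : ℚ) + 3 * k = e + 2 * n := by exact_mod_cast hk
      linarith

theorem cons32_mem_T {n c e k : ℕ} {x : ℕ →₀ ℕ} (hc : c ≤ 2) (he : e ≤ 1)
    (h : c + 3 * k = e + 2 * n) (hx : x ∈ T k) : cons32 c x ∈ T n := by
  rw [mem_T_iff_tail32, cons32_zero, tail32_cons32]
  exact ⟨hc, e, k, he, h, hx⟩

theorem T_nonempty (n : ℕ) : (T n).Nonempty := by
  induction n using Nat.strong_induction_on with
  | _ n ih =>
    rcases Nat.eq_zero_or_pos n with rfl | hn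
    · exact ⟨0, fun i => by simp, 0, fun i => by simp, by simp⟩
    · obtain ⟨x, hx⟩ := ih (2 * n / 3) (by omega)
      exact ⟨_, cons32_mem_T (c := 2 * n % 3) (e := 0) (by omega) (by omega) (by omega) hx⟩

/-- The strings in `T n` satisfy the two-out-of-three property: for any realized
suffix (the digits below position `m` of some `x ∈ T n`), the digit at
position `m` takes exactly two of the three possible values. -/
theorem two_out_of_three_property (n m : ℕ) (x : ℕ →₀ ℕ) (hx : x ∈ T n) :
    {c : ℕ | ∃ y ∈ T n, (∀ i < m, y i = x i) ∧ y m = c}.ncard = 2 := by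
  induction m generalizing n x with
  | zero =>
    have hset : {c : ℕ | ∃ y ∈ T n, (∀ i < 0, y i = x i) ∧ y 0 = c} =
        {2 * n % 3, (2 * n + 1) % 3} := by
      ext c
      simp only [Set.mem_ofPred_eq, Set.mem_insert_iff, Set.mem_singleton_iff]
      constructor
      · rintro ⟨y, hy, -, rfl⟩
        obtain ⟨h0, e, k, he, hk, -⟩ := (mem_T_iff_tail32 n y).mp hy
        interval_cases e <;> omega
      · rintro (rfl | rfl)
        · obtain ⟨y, hy⟩ := T_nonempty (2 * n / 3)
          exact ⟨_, cons32_mem_T (e := 0) (by omega) (by omega) (by omega) hy, by simp,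
            cons32_zero _ _⟩
        · obtain ⟨y, hy⟩ := T_nonempty ((2 * n + 1) / 3)
          exact ⟨_, cons32_mem_T (e := 1) (by omega) (by omega) (by omega) hy, by simp,
            cons32_zero _ _⟩
    rw [hset]
    exact Set.ncard_pair (by omega)
  | succ m ih =>
    obtain ⟨h0, e, k, he, hk, hx'⟩ := (mem_T_iff_tail32 n x).mp hx
    rw [← ih k (tail32 x) hx']
    congr 1
    ext c
    constructor
    · rintro ⟨y, hy, hyx, hc⟩
      obtain ⟨-, e', k', he', hk', hy'⟩ := (mem_T_iff_tail32 n y).mp hy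
      have hy0 := hyx 0 (by omega)
      obtain rfl : k' = k := by omega
      exact ⟨tail32 y, hy', fun i hi => hyx (i + 1) (by omega), hc⟩
    · rintro ⟨y, hy, hyx, hc⟩
      refine ⟨cons32 (x 0) y, cons32_mem_T h0 he hk hy, fun i hi => ?_, ?_⟩
      · cases i with
        | zero => exact cons32_zero _ _
        | succ i => rw [cons32_succ, hyx i (by omega), tail32_apply]
      · rw [cons32_succ, hc]
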